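/- Let n ≥ 1, let X and Y be finite posets in P^f_n, and let u : X → Y be a p-morphism. If X satisfies condition (*_n), then the image u(X) is an n-connected subset of Y. -/

import Mathlib

/-- The set of minimal elements of a poset `X` lying below `x`. -/
def minBelow (X : Type*) [PartialOrder X] (x : X) : Set X :=
  {m | m ≤ x ∧ ∀ z : X, z ≤ m → z = m}

/-- A p-morphism between posets: a monotone map commuting with `minBelow`. -/
def IsPMorphism {X Y : Type*} [PartialOrder X] [PartialOrder Y] (u : X → Y) : Prop :=
  Monotone u ∧ ∀ x : X, u '' minBelow X x = minBelow Y (u x)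

/-- Condition `(*)`. -/
def StarCond (X : Type*) [PartialOrder X] : Prop :=
  ∀ x y : X, ∃ z : X, IsLUB {x, y} z ∧ minBelow X z = minBelow X x ∪ minBelow X y

/-- Condition `(*_n)` for `n ≥ 1`. -/
def StarCondN (n : ℕ) (X : Type*) [PartialOrder X] : Prop :=
  ∀ x y : X, (minBelow X x ∪ minBelow X y).ncard ≤ n →
    ∃ z : X, IsLUB {x, y} z ∧ minBelow X z = minBelow X x ∪ minBelow X y

/-- Condition `(*_n)` with the convention that `(*_0)` means nonempty. -/
def StarCondN' (n : ℕ) (X : Type*) [PartialOrder X] : Prop :=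
  if n = 0 then Nonempty X else StarCondN n X

/-- The poset `X` belongs to the class `P^f_n`. -/
def InPfn (n : ℕ) (X : Type*) [PartialOrder X] : Prop :=
  ∀ x : X, (minBelow X x).ncard ≤ n

/-- `M` is a complete set for the preordered class `(S, le)`. -/
def IsCompleteSet {S : Type*} (le : S → S → Prop) (M : Set S) : Prop :=
  ∀ x : S, ∃ y ∈ M, le x y

/-- `M` is a minimal complete set for the preordered class `(S, le)`. -/
def IsMinimalCompleteSet {S : Type*} (le : S → S → Prop) (M : Set S) : Prop :=
  IsCompleteSet le M ∧ ∀ x ∈ M, ∀ y ∈ M, le x y → x = y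

/-- A connected subset of a poset. -/
def IsConnectedSub (X : Type*) [PartialOrder X] (Y : Set X) : Prop :=
  (∀ y ∈ Y, minBelow X y ⊆ Y) ∧
  ∀ x ∈ Y, ∀ y ∈ Y, ∃ z ∈ Y, x ≤ z ∧ y ≤ z ∧
    minBelow X z = minBelow X x ∪ minBelow X y

/-- An `n`-connected subset of a poset. -/
def IsNConnectedSub (n : ℕ) (X : Type*) [PartialOrder X] (Y : Set X) : Prop :=
  (∀ y ∈ Y, minBelow X y ⊆ Y) ∧
  (∀ S : Set X, S ⊆ (⋃ y ∈ Y, minBelow X y) → S.Nonempty → S.ncard ≤ n →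
    ∃ z ∈ Y, minBelow X z = S) ∧
  (∀ x ∈ Y, ∀ y ∈ Y, minBelow X x = minBelow X y → (minBelow X x).ncard < n →
    ∃ (r : ℕ) (c : ℕ → X), c 0 = x ∧ c r = y ∧ (∀ i ≤ r, c i ∈ Y) ∧
      (∀ i ≤ r, minBelow X (c i) = minBelow X x) ∧
      (∀ i < r, if Even i then c (i + 1) ≤ c i else c i ≤ c (i + 1)))

/-- The special product `X ⊙ Y`. -/
abbrev Odot (X Y : Type*) : Type _ :=
  {p : WithBot X × WithBot Y // p ≠ (⊥, ⊥)}

/-- The subposet `(X)_n` of elements with at most `n` minimal elements below them. -/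
abbrev SubPn (n : ℕ) (X : Type*) [PartialOrder X] : Type _ :=
  {x : X // (minBelow X x).ncard ≤ n}

/-- A unifier for a finite poset `X`: a p-morphism into `X` from a nonempty finite
poset satisfying `(*)`. -/
structure Unifier (X : Type) [PartialOrder X] [Finite X] : Type 1 where
  Y : Type
  [po : PartialOrder Y]
  [fin : Finite Y]
  ne : Nonempty Y
  star : StarCond Y
  u : Y → X
  hu : IsPMorphism u

attribute [instance] Unifier.po Unifier.fin

/-- The "more general" preorder on unifiers: `v ≼ w`. -/
def UnifierLE {X : Type} [PartialOrder X] [Finite X] (v w : Unifier X) : Prop :=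
  ∃ ψ : v.Y → w.Y, IsPMorphism ψ ∧ w.u ∘ ψ = v.u

/-- An `n`-unifier for a finite poset `X` in `P^f_n`. -/
structure UnifierN (n : ℕ) (X : Type) [PartialOrder X] [Finite X] : Type 1 where
  Y : Type
  [po : PartialOrder Y]
  [fin : Finite Y]
  ne : Nonempty Y
  mem : InPfn n Y
  star : StarCondN n Y
  u : Y → X
  hu : IsPMorphism u

attribute [instance] UnifierN.po UnifierN.fin

/-- The "more general" preorder on `n`-unifiers: `v ≼ w`. -/
def UnifierNLE {n : ℕ} {X : Type} [PartialOrder X] [Finite X] (v w : UnifierN n X) : Prop :=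
  ∃ ψ : v.Y → w.Y, IsPMorphism ψ ∧ w.u ∘ ψ = v.u

open Relation

lemma minBelow_nonempty {X : Type*} [PartialOrder X] [Finite X] (x : X) :
    (minBelow X x).Nonempty := by
  obtain ⟨m, hmx, hm⟩ := (Set.toFinite (Set.univ : Set X)).exists_le_minimal (Set.mem_univ x)
  exact ⟨m, hmx, fun z hz => le_antisymm hz (hm.2 (Set.mem_univ z) hz)⟩

lemma minBelow_eq_singleton {X : Type*} [PartialOrder X] {a : X} (ha : ∀ z ≤ a, z = a) :
    minBelow X a = {a} := by
  ext m
  constructor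
  · exact fun hm => ha m hm.1
  · rintro rfl
    exact ⟨le_rfl, ha⟩

/-- Under `(*_n)`, a nonempty set of at most `n` minimal elements has a join, and the join has
no further minimal elements below it. -/
lemma StarCondN.exists_isLUB {n : ℕ} {X : Type*} [PartialOrder X] [Finite X]
    (h : StarCondN n X) {A : Set X} (hne : A.Nonempty) (hmin : ∀ a ∈ A, ∀ z ≤ a, z = a)
    (hcard : A.ncard ≤ n) : ∃ z, IsLUB A z ∧ minBelow X z = A := by
  induction A, A.toFinite using Set.Finite.induction_on with
  | empty => exact absurd hne Set.not_nonempty_empty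
  | @insert a A _ hA ih =>
    have ha := minBelow_eq_singleton (hmin a (Set.mem_insert a A))
    rcases A.eq_empty_or_nonempty with rfl | hne'
    · exact ⟨a, by simp, by simpa using ha⟩
    · obtain ⟨z, hz, hzA⟩ := ih hne' (fun b hb => hmin b (Set.mem_insert_of_mem a hb))
        ((Set.ncard_le_ncard (Set.subset_insert a A)).trans hcard)
      obtain ⟨w, hw, hwA⟩ := h a z (by rwa [ha, hzA, Set.singleton_union])
      refine ⟨w, ?_, by rw [hwA, ha, hzA, Set.singleton_union]⟩
      refine ⟨?_, fun c hc => hw.2 ?_⟩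
      · rintro b (rfl | hb)
        · exact hw.1 (by simp)
        · exact (hz.1 hb).trans (hw.1 (by simp))
      · rintro b (rfl | rfl)
        · exact hc (Set.mem_insert _ _)
        · exact hz.2 fun d hd => hc (Set.mem_insert_of_mem a hd)

/-- Comparability of two elements of `P`. -/
def ComparableIn {Y : Type*} [PartialOrder Y] (P : Set Y) (p q : Y) : Prop :=
  p ∈ P ∧ q ∈ P ∧ (p ≤ q ∨ q ≤ p)

/-- A chain of comparabilities can be refined to an alternating zigzag. -/
lemma exists_zigzag {Y : Type*} [PartialOrder Y] {P : Set Y} {x y : Y} (hy : y ∈ P)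
    (h : ReflTransGen (ComparableIn P) x y) :
    ∃ (r : ℕ) (c : ℕ → Y), c 0 = x ∧ c r = y ∧ (∀ i ≤ r, c i ∈ P) ∧
      ∀ i < r, if Even i then c (i + 1) ≤ c i else c i ≤ c (i + 1) := by
  induction h using ReflTransGen.head_induction_on with
  | refl => exact ⟨0, fun _ => y, rfl, rfl, fun _ _ => hy, by simp⟩
  | @head p q hpq _ ih =>
    obtain ⟨r, c, h0, hr, hP, hc⟩ := ih
    obtain ⟨hp, hq, hcomp⟩ := hpq
    obtain ⟨w, hw, hwp, hwq⟩ : ∃ w ∈ P, w ≤ p ∧ w ≤ q :=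
      hcomp.elim (fun h => ⟨p, hp, le_rfl, h⟩) (fun h => ⟨q, hq, h, le_rfl⟩)
    let d : ℕ → Y
      | 0 => p
      | 1 => w
      | i + 2 => c i
    refine ⟨r + 2, d, rfl, hr, ?_, ?_⟩
    · rintro (_ | _ | i) hi
      exacts [hp, hw, hP i (by omega)]
    · rintro (_ | _ | i) hi
      · simpa [d] using hwp
      · simpa [d, h0] using hwq
      · simpa [d, Nat.even_add] using hc i (by omega)

/-- A section over `T` of `u`, taking minimal values. -/
def IsMinSection {X Y : Type*} [PartialOrder X] (u : X → Y) (T : Set Y) (f : Y → X) : Prop :=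
  ∀ t ∈ T, (∀ z ≤ f t, z = f t) ∧ u (f t) = t

section

variable {n : ℕ} {X Y : Type*} [PartialOrder X] {u : X → Y} {T : Set Y}

lemma IsMinSection.image_image {f : Y → X} (hf : IsMinSection u T f) : u '' (f '' T) = T := by
  rw [Set.image_image]
  exact (Set.image_congr fun t ht => (hf t ht).2).trans (Set.image_id' T)

lemma exists_isMinSection {A : Set X} (hA : ∀ a ∈ A, ∀ z ≤ a, z = a) [Nonempty X]
    (hT : T ⊆ u '' A) : ∃ f : Y → X, IsMinSection u T f ∧ f '' T ⊆ A := by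
  choose! f hf using hT
  exact ⟨f, fun t ht => ⟨hA _ (hf ht).1, (hf ht).2⟩, Set.image_subset_iff.2 fun t ht => (hf ht).1⟩

variable [Finite X] [Finite Y]

lemma IsMinSection.exists_isLUB {f : Y → X} (hf : IsMinSection u T f) (hstar : StarCondN n X)
    (hne : T.Nonempty) (hcard : T.ncard ≤ n) :
    ∃ z, IsLUB (f '' T) z ∧ minBelow X z = f '' T :=
  hstar.exists_isLUB (hne.image f) (Set.forall_mem_image.2 fun t ht => (hf t ht).1)
    ((Set.ncard_image_le T.toFinite).trans hcard)

/-- Joins of two sections over `T` that differ only on `D` have connected images: exchange the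
values of the sections one at a time. -/
lemma reflTransGen_of_isMinSection [PartialOrder Y] (hu : IsPMorphism u) (hstar : StarCondN n X)
    (hne : T.Nonempty) (hcard : T.ncard < n) {f : Y → X} (hf : IsMinSection u T f)
    {a : X} (ha : IsLUB (f '' T) a) (D : Set Y) {g : Y → X} (hg : IsMinSection u T g)
    (hfg : ∀ t ∉ D, g t = f t) {b : X} (hb : IsLUB (g '' T) b) (hbm : minBelow X b = g '' T) :
    ReflTransGen (ComparableIn {p ∈ Set.range u | minBelow Y p = T}) (u a) (u b) := by
  classical
  induction D, D.toFinite using Set.Finite.induction_on generalizing g b with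
  | empty =>
    obtain rfl : g = f := funext fun t => hfg t (Set.notMem_empty t)
    rw [ha.unique hb]
  | @insert s D _ _ ih =>
    let k := Function.update g s (f s)
    have hk : IsMinSection u T k := fun t ht => by
      by_cases hts : t = s
      · subst hts; simpa [k] using hf t ht
      · simpa [k, hts] using hg t ht
    obtain ⟨c, hc, hcm⟩ := hk.exists_isLUB hstar hne hcard.le
    have hac := ih hk (fun t ht => by
      by_cases hts : t = s
      · subst hts; simp [k]
      · simpa [k, hts] using hfg t (by simp [hts, ht])) hc hcm
    obtain ⟨w, hw, hwm⟩ := hstar c b (by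
      rw [hcm, hbm]
      have hsub : k '' T ∪ g '' T ⊆ insert (f s) (g '' T) := by
        refine Set.union_subset (Set.image_subset_iff.2 fun t ht => ?_) (Set.subset_insert _ _)
        by_cases hts : t = s
        · subst hts; simp [k]
        · exact Or.inr ⟨t, ht, by simp [k, hts]⟩
      have h₁ := Set.ncard_le_ncard hsub
      have h₂ := Set.ncard_insert_le (f s) (g '' T)
      have h₃ := Set.ncard_image_le (f := g) T.toFinite
      omega)
    have hP : ∀ z, u '' minBelow X z = T → u z ∈ {p ∈ Set.range u | minBelow Y p = T} :=
      fun z hz => ⟨⟨z, rfl⟩, by rw [← hu.2, hz]⟩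
    have hcP := hP c (by rw [hcm, hk.image_image])
    have hbP := hP b (by rw [hbm, hg.image_image])
    have hwP := hP w (by
      rw [hwm, hcm, hbm, Set.image_union, hk.image_image, hg.image_image, Set.union_self])
    exact (hac.tail ⟨hcP, hwP, Or.inl (hu.1 (hw.1 (by simp)))⟩).tail
      ⟨hwP, hbP, Or.inr (hu.1 (hw.1 (by simp)))⟩

end

/-- The image of a p-morphism between posets in `P^f_n` whose domain satisfies `(*_n)`
is an `n`-connected subset. -/
theorem range_of_pMorphism_n_connected (n : ℕ) (hn : 1 ≤ n) (X Y : Type*)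
    [PartialOrder X] [PartialOrder Y] [Finite X] [Finite Y]
    (hX : InPfn n X) (hY : InPfn n Y)
    (u : X → Y) (hu : IsPMorphism u) (hstar : StarCondN n X) :
    IsNConnectedSub n Y (Set.range u) := by
  have hmem : ∀ y ∈ Set.range u, ∀ t ∈ minBelow Y y, ∃ m, (∀ z ≤ m, z = m) ∧ u m = t := by
    rintro _ ⟨a, rfl⟩ t ht
    rw [← hu.2] at ht
    obtain ⟨m, hm, rfl⟩ := ht
    exact ⟨m, hm.2, rfl⟩
  refine ⟨fun y hy t ht => ?_, fun S hS hne hcard => ?_, ?_⟩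
  · obtain ⟨m, -, rfl⟩ := hmem y hy t ht
    exact ⟨m, rfl⟩
  · have hS' : S ⊆ u '' {m | ∀ z ≤ m, z = m} := fun t ht => by
      obtain ⟨y, hy, hty⟩ := Set.mem_iUnion₂.1 (hS ht)
      exact hmem y hy t hty
    have : Nonempty X := (hne.mono hS').of_image.to_type
    obtain ⟨f, hf, -⟩ := exists_isMinSection (fun _ h => h) hS'
    obtain ⟨z, -, hz⟩ := hf.exists_isLUB hstar hne hcard
    exact ⟨u z, ⟨z, rfl⟩, by rw [← hu.2, hz, hf.image_image]⟩
  · rintro _ ⟨a, rfl⟩ _ ⟨b, rfl⟩ hab hcard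
    have : Nonempty X := ⟨a⟩
    have hne := minBelow_nonempty (u a)
    set T := minBelow Y (u a)
    have hsec : ∀ x, minBelow Y (u x) = T → ∃ f : Y → X, IsMinSection u T f ∧
        ∃ z, IsLUB (f '' T) z ∧ minBelow X z = f '' T ∧ u z ≤ u x ∧ minBelow Y (u z) = T := by
      intro x hx
      obtain ⟨f, hf, hfx⟩ := exists_isMinSection (u := u) (T := T) (A := minBelow X x)
        (fun m hm => hm.2) (by rw [hu.2, hx])
      obtain ⟨z, hz, hzm⟩ := hf.exists_isLUB hstar hne hcard.le
      exact ⟨f, hf, z, hz, hzm, hu.1 (hz.2 fun m hm => (hfx hm).1),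
        by rw [← hu.2, hzm, hf.image_image]⟩
    obtain ⟨f, hf, a', ha', -, haa', haT⟩ := hsec a rfl
    obtain ⟨g, hg, b', hb', hbm', hbb', hbT⟩ := hsec b hab.symm
    have hchain := reflTransGen_of_isMinSection hu hstar hne hcard hf ha' Set.univ hg
      (fun t ht => absurd (Set.mem_univ t) ht) hb' hbm'
    obtain ⟨r, c, h0, hr, hP, hc⟩ := exists_zigzag
      (P := {p ∈ Set.range u | minBelow Y p = T}) ⟨⟨b, rfl⟩, hab.symm⟩
      ((hchain.head ⟨⟨⟨a, rfl⟩, rfl⟩, ⟨⟨a', rfl⟩, haT⟩, Or.inr haa'⟩).tail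
        ⟨⟨⟨b', rfl⟩, hbT⟩, ⟨⟨b, rfl⟩, hab.symm⟩, Or.inl hbb'⟩)
    exact ⟨r, c, h0, hr, fun i hi => (hP i hi).1, fun i hi => (hP i hi).2, hc⟩
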